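/- arXiv:2407.05231 — 2 statements merged into one kernel-verified Lean document; each statement's English description precedes it below -/
import Mathlib

section
/- Let P be a finite set of s polynomials in ω real variables, each of degree at most a constant D. The number of realizable sign condition vectors of P (vectors in {−1,0,+1}^s realized by some point of ℝ^ω) is at most s^ω · C^ω for a constant C depending only on D. -/
open MvPolynomial in
/-- A diagonal system `x_j ^ e = g_j(x)` with `deg g_j < e` has at most `e ^ n` solutions. -/
theorem sc_diagonal_card {n e : ℕ} (g : Fin n → MvPolynomial (Fin n) ℝ)
    (hg : ∀ j, (g j).totalDegree < e) (T : Finset (Fin n → ℝ))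
    (hT : ∀ t ∈ T, ∀ j, t j ^ e = eval t (g j)) : T.card ≤ e ^ n := by
  classical
  let ev : MvPolynomial (Fin n) ℝ →ₗ[ℝ] (T → ℝ) :=
    LinearMap.pi fun t => (aeval (t : Fin n → ℝ)).toLinearMap
  have hev : ∀ p (t : T), ev p t = eval (t : Fin n → ℝ) p := by
    intro p t
    simp [ev, aeval_eq_eval]
  let b : (Fin n → Fin e) → (T → ℝ) := fun a =>
    ev (monomial (Finsupp.equivFunOnFinite.symm (fun i => (a i : ℕ))) 1)
  have hspan : ∀ k : ℕ, ∀ p : MvPolynomial (Fin n) ℝ, p.totalDegree ≤ k →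
      ev p ∈ Submodule.span ℝ (Set.range b) := by
    intro k
    induction k using Nat.strong_induction_on with
    | _ k ih =>
      intro p hp
      rw [p.as_sum, map_sum]
      refine Submodule.sum_mem _ fun a ha => ?_
      have hak : (a.sum fun _ m => m) ≤ k := (le_totalDegree ha).trans hp
      by_cases h : ∀ i, a i < e
      · have : ev (monomial a (coeff a p)) = (coeff a p) • b (fun i => ⟨a i, h i⟩) := by
          simp only [b]
          rw [← map_smul, smul_monomial]
          congr 2
          · ext i; simp
          · simp
        rw [this]
        exact Submodule.smul_mem _ _ (Submodule.subset_span ⟨_, rfl⟩)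
      · push Not at h
        obtain ⟨j, hj⟩ := h
        have hle : Finsupp.single j e ≤ a := by
          rw [Finsupp.single_le_iff]; exact hj
        have heq : a = (a - Finsupp.single j e) + Finsupp.single j e :=
          (tsub_add_cancel_of_le hle).symm
        have hdeg : ((a - Finsupp.single j e).sum fun _ m => m) + e = (a.sum fun _ m => m) := by
          conv_rhs => rw [heq]
          rw [Finsupp.sum_add_index' (by simp) (by simp)]
          simp
        have hred : ev (monomial a (coeff a p)) =
            ev (monomial (a - Finsupp.single j e) (coeff a p) * g j) := by
          ext t
          rw [hev, hev, map_mul, ← hT t t.2 j]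
          have h5 : monomial a (coeff a p) = monomial (a - Finsupp.single j e) (coeff a p) *
              monomial (Finsupp.single j e) 1 := by
            rw [monomial_mul, mul_one, ← heq]
          rw [h5, map_mul]
          congr 1
          simp [eval_monomial]
        rw [hred]
        have h1 := totalDegree_mul (monomial (a - Finsupp.single j e) (coeff a p)) (g j)
        have h2 := totalDegree_monomial_le (a - Finsupp.single j e) (coeff a p)
        have h3 := hg j
        refine ih _ ?_ _ le_rfl
        have h4 : (monomial (a - Finsupp.single j e) (coeff a p)).totalDegree ≤ 
            ((a - Finsupp.single j e).sum fun _ m => m) := h2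
        omega
  have htop : Submodule.span ℝ (Set.range b) = ⊤ := by
    rw [eq_top_iff, ← (Pi.basisFun ℝ T).span_eq, Submodule.span_le]
    rintro _ ⟨t, rfl⟩
    let q : MvPolynomial (Fin n) ℝ :=
      ∏ t' ∈ T.erase t, ∑ j, (X j - C (t' j)) ^ 2
    have hq : eval (t : Fin n → ℝ) q ≠ 0 := by
      simp only [q, map_prod, Finset.prod_ne_zero_iff]
      intro t' ht' h0
      simp only [map_sum, map_pow, map_sub, eval_X, eval_C] at h0
      rw [Finset.sum_eq_zero_iff_of_nonneg (fun _ _ => sq_nonneg _)] at h0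
      apply (Finset.mem_erase.1 ht').1
      ext j
      have := h0 j (Finset.mem_univ _)
      have := pow_eq_zero_iff (two_ne_zero) |>.1 this
      linarith
    have hq0 : ∀ t' : T, t' ≠ t → eval (t' : Fin n → ℝ) q = 0 := by
      intro t' ht'
      simp only [q, map_prod]
      refine Finset.prod_eq_zero (i := (t' : Fin n → ℝ))
        (Finset.mem_erase.2 ⟨fun h => ht' (Subtype.ext h), t'.2⟩) ?_
      simp
    have : Pi.basisFun ℝ T t = ev ((eval (t : Fin n → ℝ) q)⁻¹ • q) := by
      ext t'
      rw [hev, smul_eval]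
      by_cases h : t' = t
      · subst h
        simp [inv_mul_cancel₀ hq]
      · rw [hq0 t' h]
        simp [h]
    rw [this]
    exact hspan _ _ le_rfl
  have := finrank_range_le_card (R := ℝ) b
  rw [Set.finrank, htop, finrank_top] at this
  simpa using this

open MvPolynomial in
theorem sc_growth {n : ℕ} (p : MvPolynomial (Fin n) ℝ) :
    ∃ A : ℝ, 0 ≤ A ∧ ∀ x : Fin n → ℝ, 1 ≤ ‖x‖ → |eval x p| ≤ A * ‖x‖ ^ p.totalDegree := by
  refine ⟨∑ a ∈ p.support, |coeff a p|, Finset.sum_nonneg fun _ _ => abs_nonneg _, ?_⟩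
  intro x hx
  rw [eval_eq, Finset.sum_mul]
  refine (Finset.abs_sum_le_sum_abs _ _).trans (Finset.sum_le_sum fun a ha => ?_)
  rw [abs_mul, Finset.abs_prod]
  refine mul_le_mul_of_nonneg_left ?_ (abs_nonneg _)
  have h1 : ∏ i ∈ a.support, |x i ^ a i| ≤ ∏ i ∈ a.support, ‖x‖ ^ a i := by
    refine Finset.prod_le_prod (fun _ _ => abs_nonneg _) fun i _ => ?_
    rw [abs_pow]
    exact pow_le_pow_left₀ (abs_nonneg _) (norm_le_pi_norm x i) _
  refine h1.trans ?_
  rw [Finset.prod_pow_eq_pow_sum]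
  exact pow_le_pow_right₀ hx (le_totalDegree ha)

open MvPolynomial in
theorem sc_hasDerivAt {n : ℕ} (p : MvPolynomial (Fin n) ℝ) (x : Fin n → ℝ) (j : Fin n) :
    HasDerivAt (fun τ : ℝ => eval (Function.update x j τ) p) (eval x (pderiv j p)) (x j) := by
  induction p using MvPolynomial.induction_on with
  | C a => simpa using hasDerivAt_const (x j) a
  | add p q hp hq => simpa using hp.fun_add hq
  | mul_X p i hp =>
    have hX : HasDerivAt (fun τ : ℝ => Function.update x j τ i)
        (eval x (pderiv j (X i : MvPolynomial (Fin n) ℝ))) (x j) := by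
      by_cases h : i = j
      · subst h
        simpa using hasDerivAt_id' (x i)
      · simpa [pderiv_X_of_ne h, Function.update_of_ne h] using hasDerivAt_const (x j) (x i)
    have := hp.fun_mul hX
    simp only [Function.update_eq_self] at this
    have h2 : eval x (pderiv j (p * X i)) =
        eval x (pderiv j p) * x i + eval x p * eval x (pderiv j (X i)) := by
      rw [pderiv_mul]; simp
    rw [h2]
    simpa only [map_mul, eval_X] using this

open MvPolynomial in
theorem sc_totalDegree_pderiv {n : ℕ} (p : MvPolynomial (Fin n) ℝ) (j : Fin n) :
    (pderiv j p).totalDegree ≤ p.totalDegree := by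
  conv_lhs => rw [p.as_sum, map_sum]
  refine totalDegree_finsetSum_le fun a ha => ?_
  rw [pderiv_monomial]
  refine (totalDegree_monomial_le _ _).trans (le_trans ?_ (le_totalDegree ha))
  have h : a - Finsupp.single j 1 ≤ a := tsub_le_self
  exact Finsupp.sum_le_sum_index h (fun _ _ _ _ h => h) (fun _ _ => rfl)

open MvPolynomial in
/-- The perturbed polynomial `Q ^ 2 - ε ∑ x_j ^ M` has a critical point in every cell. -/
theorem sc_cell {n M : ℕ} (Q : MvPolynomial (Fin n) ℝ) (K : Set (Fin n → ℝ)) (hK : IsClosed K)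
    (hint : ∀ x ∈ K, eval x Q ≠ 0 → K ∈ nhds x) (hM : Even M)
    (hdeg : (Q ^ 2).totalDegree < M) {ε : ℝ} (hε : 0 < ε) (u : Fin n → ℝ) (hu : u ∈ K)
    (hpos : 0 < eval u Q ^ 2 - ε * ∑ j, u j ^ M) :
    ∃ x ∈ K, eval x Q ≠ 0 ∧ ∀ j, ε * (M * x j ^ (M - 1)) = eval x (pderiv j (Q ^ 2)) := by
  let F : MvPolynomial (Fin n) ℝ := Q ^ 2 - C ε * ∑ j, X j ^ M
  have hF : ∀ x, eval x F = eval x Q ^ 2 - ε * ∑ j, x j ^ M := by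
    intro x; simp [F]
  have hcont : Continuous fun x => eval x F := continuous_eval F
  have hsum : ∀ x : Fin n → ℝ, 0 ≤ ∑ j, x j ^ M := fun x =>
    Finset.sum_nonneg fun j _ => hM.pow_nonneg _
  obtain ⟨A, hA0, hA⟩ := sc_growth (Q ^ 2)
  let R : ℝ := max 1 (A / ε)
  have hR : ∀ x : Fin n → ℝ, 0 < eval x F → ‖x‖ ≤ R := by
    intro x hx
    by_contra! hlt
    have h1 : 1 < ‖x‖ := (le_max_left _ _).trans_lt hlt
    have h2 : A < ε * ‖x‖ := by
      have := (le_max_right 1 (A / ε)).trans_lt hlt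
      rw [div_lt_iff₀ hε] at this
      linarith
    have h3 := (le_abs_self _).trans (hA x h1.le)
    rw [map_pow] at h3
    have h4 : ‖x‖ ^ M ≤ ∑ j, x j ^ M := by
      have hn : Nonempty (Fin n) := by
        by_contra hne
        rw [not_nonempty_iff] at hne
        have : x = 0 := Subsingleton.elim _ _
        rw [this, norm_zero] at h1
        linarith
      obtain ⟨j, hj⟩ : ∃ j, ‖x‖ = ‖x j‖ := by
        obtain ⟨j, hj⟩ := Finite.exists_max (fun j => ‖x j‖)
        exact ⟨j, le_antisymm ((pi_norm_le_iff_of_nonneg (norm_nonneg _)).2 hj)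
          (norm_le_pi_norm x j)⟩
      rw [hj, Real.norm_eq_abs, hM.pow_abs]
      exact Finset.single_le_sum (f := fun j => x j ^ M) (fun j _ => hM.pow_nonneg _)
        (Finset.mem_univ j)
    have h5 : ‖x‖ ^ ((Q ^ 2).totalDegree + 1) ≤ ‖x‖ ^ M := pow_le_pow_right₀ h1.le hdeg
    have h6 : 0 < ‖x‖ ^ (Q ^ 2).totalDegree := by positivity
    have h7 : A * ‖x‖ ^ (Q ^ 2).totalDegree < ε * ‖x‖ * ‖x‖ ^ (Q ^ 2).totalDegree :=
      mul_lt_mul_of_pos_right h2 h6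
    have h8 : ε * ‖x‖ ^ ((Q ^ 2).totalDegree + 1) ≤ ε * ∑ j, x j ^ M :=
      mul_le_mul_of_nonneg_left (h5.trans h4) hε.le
    rw [pow_succ] at h8
    rw [hF] at hx
    nlinarith
  have hcomp : IsCompact (K ∩ Metric.closedBall 0 R) :=
    (isCompact_closedBall _ _).inter_left hK
  have hmem : ∀ x ∈ K, 0 < eval x F → x ∈ K ∩ Metric.closedBall 0 R := fun x hx h =>
    ⟨hx, by simpa using hR x h⟩
  have huF : 0 < eval u F := by rw [hF]; exact hpos
  obtain ⟨x, hx, hmax⟩ := hcomp.exists_isMaxOn ⟨u, hmem u hu huF⟩ hcont.continuousOn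
  have hxF : 0 < eval x F := huF.trans_le (hmax (hmem u hu huF))
  have hxQ : eval x Q ≠ 0 := by
    intro h0
    rw [hF, h0] at hxF
    have := mul_nonneg hε.le (hsum x)
    norm_num at hxF
    linarith
  refine ⟨x, hx.1, hxQ, fun j => ?_⟩
  have hloc : IsLocalMax (fun y => eval y F) x := by
    filter_upwards [hint x hx.1 hxQ, hcont.continuousAt.eventually (lt_mem_nhds hxF)] with y h1 h2
    exact hmax (hmem y h1 h2)
  have hloc1 : IsLocalMax (fun τ : ℝ => eval (Function.update x j τ) F) (x j) := by
    have hc : Continuous fun τ : ℝ => Function.update x j τ := by fun_prop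
    have ht : Filter.Tendsto (fun τ : ℝ => Function.update x j τ) (nhds (x j)) (nhds x) := by
      simpa using hc.tendsto (x j)
    have := ht.eventually hloc
    simpa [IsLocalMax, IsMaxFilter] using this
  have h0 := hloc1.hasDerivAt_eq_zero (sc_hasDerivAt F x j)
  have h1 : eval x (pderiv j F) = eval x (pderiv j (Q ^ 2)) - ε * (M * x j ^ (M - 1)) := by
    simp only [F, map_sub, pderiv_C_mul, map_sum, Derivation.leibniz_pow, smul_eval]
    congr 1
    rw [map_mul, eval_C, map_sum, Finset.sum_eq_single j]
    · simp
    · intro i _ hij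
      simp [pderiv_X_of_ne hij]
    · simp
  linarith

open MvPolynomial in
/-- for every degree bound `D` there is a constant `C` (depending only
on `D`) such that for any set of `s ≥ 1` polynomials in `ω` real variables of total
degree at most `D`, the number of realizable sign condition vectors is at most
`s^ω * C^ω`. -/
theorem sign_conditions_bound (D : ℕ) :
    ∃ C : ℕ, 0 < C ∧ ∀ (s ω : ℕ), 1 ≤ s →
      ∀ P : Fin s → MvPolynomial (Fin ω) ℝ,
        (∀ i, (P i).totalDegree ≤ D) →
        {S : Fin s → ℝ | ∃ ν : Fin ω → ℝ,
            ∀ i, Real.sign (MvPolynomial.eval ν (P i)) = S i}.ncard ≤ s ^ ω * C ^ ω := by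
  refine ⟨4 * D + 1, by omega, ?_⟩
  intro s ω hs P hP
  classical
  set 𝒮 := {S : Fin s → ℝ | ∃ ν : Fin ω → ℝ, ∀ i, Real.sign (eval ν (P i)) = S i} with h𝒮
  rcases Set.finite_or_infinite 𝒮 with hfin | hinf
  swap
  · rw [hinf.ncard]; exact Nat.zero_le _
  have hrep : ∀ S : Fin s → ℝ, ∃ ν : Fin ω → ℝ, S ∈ 𝒮 → ∀ i, Real.sign (eval ν (P i)) = S i := by
    intro S
    by_cases h : S ∈ 𝒮
    · obtain ⟨ν, hν⟩ := h
      exact ⟨ν, fun _ => hν⟩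
    · exact ⟨0, fun h' => absurd h' h⟩
  choose u hu using hrep
  obtain ⟨δ, hδ, hδ0⟩ : ∃ δ : ℝ, (∀ S ∈ 𝒮, ∀ i, eval (u S) (P i) ≠ 0 → δ < |eval (u S) (P i)|) ∧
      0 < δ := by
    have h1 : ∀ᶠ δ in nhdsWithin (0 : ℝ) (Set.Ioi 0),
        ∀ S ∈ 𝒮, ∀ i, eval (u S) (P i) ≠ 0 → δ < |eval (u S) (P i)| := by
      rw [Filter.eventually_all_finite hfin]
      intro S _
      rw [Filter.eventually_all]
      intro i
      rw [Filter.eventually_imp_distrib_left]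
      intro h
      exact nhdsWithin_le_nhds (gt_mem_nhds (abs_pos.2 h))
    exact (h1.and self_mem_nhdsWithin).exists
  let Q : MvPolynomial (Fin ω) ℝ := ∏ i, (P i ^ 2 - C (δ ^ 2))
  have hQ : ∀ x, eval x Q = ∏ i, ((eval x (P i)) ^ 2 - δ ^ 2) := by
    intro x; simp [Q]
  let K : (Fin s → ℝ) → Set (Fin ω → ℝ) := fun S => {x | ∀ i,
    (S i = 1 → δ ≤ eval x (P i)) ∧ (S i = -1 → eval x (P i) ≤ -δ) ∧
    (S i = 0 → -δ ≤ eval x (P i) ∧ eval x (P i) ≤ δ)}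
  have hne : ∀ x, eval x Q ≠ 0 → ∀ i, eval x (P i) ≠ δ ∧ eval x (P i) ≠ -δ := by
    intro x hx i
    rw [hQ, Finset.prod_ne_zero_iff] at hx
    have := hx i (Finset.mem_univ i)
    constructor <;> intro h <;> apply this <;> rw [h] <;> ring
  have hc : ∀ i, Continuous fun x => eval x (P i) := fun i => continuous_eval (P i)
  have hKclosed : ∀ S, IsClosed (K S) := by
    intro S
    simp only [K, Set.setOf_forall, Set.setOf_and]
    refine isClosed_iInter fun i => IsClosed.inter ?_ (IsClosed.inter ?_ ?_)
    · exact isClosed_iInter fun _ => isClosed_le continuous_const (hc i)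
    · exact isClosed_iInter fun _ => isClosed_le (hc i) continuous_const
    · exact isClosed_iInter fun _ => (isClosed_le continuous_const (hc i)).inter
        (isClosed_le (hc i) continuous_const)
  have hKint : ∀ S, ∀ x ∈ K S, eval x Q ≠ 0 → K S ∈ nhds x := by
    intro S x hx hxQ
    have : ∀ᶠ y in nhds x, ∀ i,
        (S i = 1 → δ ≤ eval y (P i)) ∧ (S i = -1 → eval y (P i) ≤ -δ) ∧
        (S i = 0 → -δ ≤ eval y (P i) ∧ eval y (P i) ≤ δ) := by
      rw [Filter.eventually_all]
      intro i
      obtain ⟨h1, h2, h3⟩ := hx i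
      obtain ⟨n1, n2⟩ := hne x hxQ i
      have hlow : ∀ a, a < eval x (P i) → ∀ᶠ y in nhds x, a ≤ eval y (P i) := fun a h =>
        ((hc i).continuousAt.eventually (lt_mem_nhds h)).mono fun _ h => le_of_lt h
      have hup : ∀ a, eval x (P i) < a → ∀ᶠ y in nhds x, eval y (P i) ≤ a := fun a h =>
        ((hc i).continuousAt.eventually (gt_mem_nhds h)).mono fun _ h => le_of_lt h
      refine Filter.Eventually.and ?_ (Filter.Eventually.and ?_ ?_)
      · rw [Filter.eventually_imp_distrib_left]
        exact fun h => hlow _ (lt_of_le_of_ne (h1 h) n1.symm)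
      · rw [Filter.eventually_imp_distrib_left]
        exact fun h => hup _ (lt_of_le_of_ne (h2 h) n2)
      · rw [Filter.eventually_imp_distrib_left]
        exact fun h => (hlow _ (lt_of_le_of_ne (h3 h).1 n2.symm)).and
          (hup _ (lt_of_le_of_ne (h3 h).2 n1))
    exact this
  have huK : ∀ S ∈ 𝒮, u S ∈ K S := by
    intro S hS i
    have h1 := hu S hS i
    have h2 := hδ S hS i
    rcases lt_trichotomy (eval (u S) (P i)) 0 with h | h | h
    · rw [Real.sign_of_neg h] at h1
      have h3 := h2 h.ne
      rw [abs_of_neg h] at h3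
      rw [← h1]
      norm_num
      linarith
    · rw [h, Real.sign_zero] at h1
      rw [← h1, h]
      norm_num
      linarith
    · rw [Real.sign_of_pos h] at h1
      have h3 := h2 h.ne'
      rw [abs_of_pos h] at h3
      rw [← h1]
      norm_num
      linarith
  have huQ : ∀ S ∈ 𝒮, eval (u S) Q ≠ 0 := by
    intro S hS
    rw [hQ, Finset.prod_ne_zero_iff]
    intro i _ h0
    have h2 := hδ S hS i
    by_cases h : eval (u S) (P i) = 0
    · rw [h] at h0
      nlinarith
    · have h3 := h2 h
      have h4 := sq_abs (eval (u S) (P i))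
      nlinarith
  set M := 4 * s * D + 2 with hMdef
  obtain ⟨ε, hε, hε0⟩ : ∃ ε : ℝ, (∀ S ∈ 𝒮, 0 < eval (u S) Q ^ 2 - ε * ∑ j, u S j ^ M) ∧
      0 < ε := by
    have h1 : ∀ᶠ ε in nhdsWithin (0 : ℝ) (Set.Ioi 0),
        ∀ S ∈ 𝒮, 0 < eval (u S) Q ^ 2 - ε * ∑ j, u S j ^ M := by
      rw [Filter.eventually_all_finite hfin]
      intro S hS
      apply nhdsWithin_le_nhds
      have hcε : Continuous fun ε : ℝ => eval (u S) Q ^ 2 - ε * ∑ j, u S j ^ M := by fun_prop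
      refine hcε.continuousAt.eventually (lt_mem_nhds ?_)
      have := huQ S hS
      simp only [zero_mul, sub_zero]
      positivity
    exact (h1.and self_mem_nhdsWithin).exists
  have hQdeg : (Q ^ 2).totalDegree ≤ 4 * s * D := by
    have h1 : Q.totalDegree ≤ s * (2 * D) := by
      refine (totalDegree_finset_prod _ _).trans ?_
      refine (Finset.sum_le_card_nsmul _ _ (2 * D) fun i _ => ?_).trans (by simp)
      exact (totalDegree_sub_C_le _ _).trans ((totalDegree_pow _ _).trans
        (Nat.mul_le_mul_left 2 (hP i)))
    refine (totalDegree_pow _ _).trans ?_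
    nlinarith
  have hcell : ∀ S : Fin s → ℝ, ∃ x : Fin ω → ℝ, S ∈ 𝒮 → x ∈ K S ∧ eval x Q ≠ 0 ∧
      ∀ j, ε * (M * x j ^ (M - 1)) = eval x (pderiv j (Q ^ 2)) := by
    intro S
    by_cases hS : S ∈ 𝒮
    · obtain ⟨x, h1, h2, h3⟩ := sc_cell Q (K S) (hKclosed S) (hKint S) (M := M)
        ⟨2 * s * D + 1, by rw [hMdef]; ring⟩ (by omega) hε0 (u S) (huK S hS) (hε S hS)
      exact ⟨x, fun _ => ⟨h1, h2, h3⟩⟩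
    · exact ⟨0, fun h' => absurd h' hS⟩
  choose x hx using hcell
  have hsgn : ∀ S ∈ 𝒮, ∀ i, S i = -1 ∨ S i = 0 ∨ S i = 1 := by
    rintro S ⟨ν, hν⟩ i
    rw [← hν i]
    exact Real.sign_apply_eq _
  have hinj : Set.InjOn x 𝒮 := by
    intro S hS S' hS' heq
    obtain ⟨hk, hq, -⟩ := hx S hS
    obtain ⟨hk', -, -⟩ := hx S' hS'
    rw [← heq] at hk'
    funext i
    obtain ⟨a1, a2, a3⟩ := hk i
    obtain ⟨b1, b2, b3⟩ := hk' i
    obtain ⟨n1, n2⟩ := hne _ hq i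
    rcases hsgn S hS i with h | h | h <;> rcases hsgn S' hS' i with h' | h' | h' <;>
      rw [h, h'] <;> exfalso
    · exact n2 (le_antisymm (a2 h) (b3 h').1)
    · linarith [a2 h, b1 h']
    · exact n2 (le_antisymm (b2 h') (a3 h).1)
    · exact n1 (le_antisymm (a3 h).2 (b1 h'))
    · linarith [a1 h, b2 h']
    · exact n1 (le_antisymm (b3 h').2 (a1 h))
  have hM0 : (ε * M : ℝ) ≠ 0 := by
    have : (0 : ℝ) < M := by rw [hMdef]; positivity
    positivity
  have hcard := sc_diagonal_card (n := ω) (e := M - 1)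
    (fun j => C ((ε * M)⁻¹) * pderiv j (Q ^ 2))
    (fun j => by
      have h1 := totalDegree_mul (C ((ε * M)⁻¹)) (pderiv j (Q ^ 2))
      rw [totalDegree_C] at h1
      have h2 := sc_totalDegree_pderiv (Q ^ 2) j
      omega)
    (hfin.toFinset.image x)
    (fun t ht j => by
      obtain ⟨S, hS, rfl⟩ := Finset.mem_image.1 ht
      have h := (hx S (hfin.mem_toFinset.1 hS)).2.2 j
      rw [map_mul, eval_C, ← h, ← mul_assoc ε, inv_mul_cancel_left₀ hM0])
  rw [Finset.card_image_of_injOn (by simpa using hinj), ← Set.ncard_eq_toFinset_card _ hfin] at hcard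
  refine hcard.trans ?_
  rw [← mul_pow]
  refine Nat.pow_le_pow_left ?_ _
  have : M - 1 = 4 * s * D + 1 := by omega
  rw [this]
  nlinarith
end

section
/- Suppose R_i[j] is nonempty and let ℓ_{i,j} denote its first point along the oriented edge w_j w_{j+1}. Then for every i' with 1 ≤ i' ≤ i−1, ℓ_{i,j} ∈ {ℓ_{i',j}, s_{i'+1,j}, s_{i'+2,j}, ..., s_{i,j}}, where s_{t,j} denotes the start of the oriented segment B_{v_t} ∩ w_j w_{j+1} (if nonempty). -/
open scoped RealInnerProductSpace

/-- Piecewise-linear (polygonal) curve with `n` edges and vertices `v 0, ..., v n`,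
parameterized on `[0,1]`. -/
noncomputable def polyline {E : Type*} [NormedAddCommGroup E] [NormedSpace ℝ E]
    (n : ℕ) (v : ℕ → E) (s : ℝ) : E :=
  let u : ℝ := s * n
  let i : ℕ := min (n - 1) (⌊u⌋.toNat)
  (1 - (u - i)) • v i + (u - i) • v (i + 1)

/-- A reparameterization of `[0,1]`: continuous, monotone, fixing the endpoints. -/
def IsReparam (φ : ℝ → ℝ) : Prop :=
  Continuous φ ∧ Monotone φ ∧ φ 0 = 0 ∧ φ 1 = 1

/-- The Fréchet distance between two curves `f g : ℝ → E` (regarded as parameterized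
on `[0,1]`): the infimum of the bounds `δ` achieved by some pair of matched
reparameterizations. -/
noncomputable def frechetDist {E : Type*} [NormedAddCommGroup E] [NormedSpace ℝ E]
    (f g : ℝ → E) : ℝ :=
  sInf {δ : ℝ | 0 ≤ δ ∧ ∃ φ ψ : ℝ → ℝ, IsReparam φ ∧ IsReparam ψ ∧
    ∀ t ∈ Set.Icc (0:ℝ) 1, dist (f (φ t)) (g (ψ t)) ≤ δ}

/-- Vertices of the subcurve `τ[v 0, x]` where `x` lies on the edge from `v i` to
`v (i+1)`: the vertices `v 0, ..., v i` followed by `x`. -/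
def subVert {E : Type*} (v : ℕ → E) (i : ℕ) (x : E) : ℕ → E :=
  fun k => if k ≤ i then v k else x

noncomputable def fpPl {E : Type*} [NormedAddCommGroup E] [NormedSpace ℝ E]
    (v : ℕ → E) (u : ℝ) : E :=
  (1 - (u - ⌊u⌋₊)) • v ⌊u⌋₊ + (u - ⌊u⌋₊) • v (⌊u⌋₊ + 1)

section fp
variable {E : Type*} [NormedAddCommGroup E] [NormedSpace ℝ E]

lemma fpPl_eq (v : ℕ → E) (i : ℕ) (u : ℝ) (h0 : (i:ℝ) ≤ u) (h1 : u ≤ i + 1) :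
    fpPl v u = (1 - (u - i)) • v i + (u - i) • v (i + 1) := by
  rcases h1.lt_or_eq with h | h
  · have : ⌊u⌋₊ = i := by
      rw [Nat.floor_eq_iff ((Nat.cast_nonneg i).trans h0)]; exact ⟨h0, h⟩
    simp [fpPl, this]
  · have : ⌊u⌋₊ = i + 1 := by
      rw [h]; exact_mod_cast Nat.floor_natCast (R := ℝ) (i + 1)
    simp only [fpPl, this]
    subst h
    simp

lemma fp_polyline_eq (n : ℕ) (v : ℕ → E) (s : ℝ) (h0 : 0 ≤ s) (h1 : s ≤ 1) :
    polyline n v s = fpPl v (s * n) := by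
  have hu : 0 ≤ s * n := by positivity
  have hu1 : s * n ≤ n := by nlinarith [Nat.cast_nonneg (α := ℝ) n]
  have hf : (⌊s * n⌋.toNat) = ⌊s * n⌋₊ := rfl
  have hfl := Nat.floor_le hu
  have hlt := Nat.lt_floor_add_one (s * n)
  simp only [polyline]
  rw [hf]
  symm
  apply fpPl_eq
  · refine le_trans ?_ hfl
    exact_mod_cast min_le_right _ _
  · rcases le_total (n - 1) ⌊s * n⌋₊ with h | h
    · rw [min_eq_left h]
      have : n ≤ (n - 1) + 1 := by omega
      have : (n:ℝ) ≤ ((n - 1 : ℕ):ℝ) + 1 := by exact_mod_cast this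
      linarith
    · rw [min_eq_right h]; linarith

noncomputable def fpG (j : ℕ) (t u : ℝ) : ℝ := min u j + t * max (u - j) 0

lemma fp_subVert_eq (w : ℕ → E) (j : ℕ) (t u : ℝ) (ht0 : 0 ≤ t) (ht1 : t ≤ 1)
    (h0 : 0 ≤ u) (h1 : u ≤ j + 1) :
    fpPl (subVert w j ((1-t) • w j + t • w (j+1))) u = fpPl w (fpG j t u) := by
  rcases lt_or_ge u j with h | h
  · have hg : fpG j t u = u := by
      rw [fpG, min_eq_left h.le, max_eq_right (by linarith)]; ring
    rw [hg]
    have : ⌊u⌋₊ < j := (Nat.floor_lt h0).2 h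
    have h2 : ⌊u⌋₊ + 1 ≤ j := this
    simp [fpPl, subVert, this.le, h2]
  · have hg : fpG j t u = j + t * (u - j) := by
      rw [fpG, min_eq_right h, max_eq_left (by linarith)]
    rw [hg, fpPl_eq _ j u h h1, fpPl_eq _ j _ (by nlinarith) (by nlinarith)]
    simp only [subVert, le_refl, if_true, Nat.not_succ_le_self, if_false]
    module

lemma fp_bound (n : ℕ) (v : ℕ → E) (s : ℝ) (h0 : 0 ≤ s) (h1 : s ≤ 1) :
    ‖polyline n v s‖ ≤ 2 * ∑ m ∈ Finset.range (n + 2), ‖v m‖ := by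
  rw [fp_polyline_eq n v s h0 h1]
  have hu : 0 ≤ s * n := by positivity
  have hu1 : s * n ≤ n := by nlinarith [Nat.cast_nonneg (α := ℝ) n]
  have hfl := Nat.floor_le hu
  have hlt := Nat.lt_floor_add_one (s * n)
  have hn : ⌊s * n⌋₊ ≤ n := by
    have := Nat.floor_le_floor hu1
    simpa using this
  have key : ∀ m, m < n + 2 → ‖v m‖ ≤ ∑ m ∈ Finset.range (n + 2), ‖v m‖ := fun m hm =>
    Finset.single_le_sum (f := fun m => ‖v m‖) (fun _ _ => norm_nonneg _) (Finset.mem_range.2 hm)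
  have a1 := key ⌊s * n⌋₊ (by omega)
  have a2 := key (⌊s * n⌋₊ + 1) (by omega)
  rw [fpPl]
  refine (norm_add_le _ _).trans ?_
  rw [norm_smul, norm_smul, Real.norm_of_nonneg (by linarith), Real.norm_of_nonneg (by linarith)]
  nlinarith [norm_nonneg (v ⌊s * n⌋₊), norm_nonneg (v (⌊s * n⌋₊ + 1))]

def fpReach (P Q : ℝ → E) (ε a b : ℝ) : Prop :=
  ∃ φ ψ : ℝ → ℝ, Continuous φ ∧ Monotone φ ∧ Continuous ψ ∧ Monotone ψ ∧
    φ 0 = 0 ∧ ψ 0 = 0 ∧ φ 1 = a ∧ ψ 1 = b ∧ ∀ t ∈ Set.Icc (0:ℝ) 1, dist (P (φ t)) (Q (ψ t)) ≤ ε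

lemma fpReach.mono {P Q : ℝ → E} {ε ε' a b : ℝ} (h : fpReach P Q ε a b) (he : ε ≤ ε') :
    fpReach P Q ε' a b := by
  obtain ⟨φ, ψ, h1, h2, h3, h4, h5, h6, h7, h8, h9⟩ := h
  exact ⟨φ, ψ, h1, h2, h3, h4, h5, h6, h7, h8, fun t ht => (h9 t ht).trans he⟩

lemma fpReach.dist_le {P Q : ℝ → E} {ε a b : ℝ} (h : fpReach P Q ε a b) :
    dist (P a) (Q b) ≤ ε := by
  obtain ⟨φ, ψ, h1, h2, h3, h4, h5, h6, h7, h8, h9⟩ := h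
  have := h9 1 (by simp)
  rwa [h7, h8] at this

lemma fpReach.extend {P Q : ℝ → E} {ε a b a' b' : ℝ} (h : fpReach P Q ε a b)
    (ha : a ≤ a') (hb : b ≤ b')
    (hs : ∀ s ∈ Set.Icc (0:ℝ) 1, dist (P (a + s * (a' - a))) (Q (b + s * (b' - b))) ≤ ε) :
    fpReach P Q ε a' b' := by
  obtain ⟨φ, ψ, h1, h2, h3, h4, h5, h6, h7, h8, h9⟩ := h
  have mm : Monotone fun t : ℝ => min (2 * t) 1 := fun x y hxy => by
    dsimp only; gcongr
  have mx : Monotone fun t : ℝ => max (2 * t - 1) 0 := fun x y hxy => by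
    dsimp only; gcongr
  refine ⟨fun t => φ (min (2 * t) 1) + max (2 * t - 1) 0 * (a' - a),
    fun t => ψ (min (2 * t) 1) + max (2 * t - 1) 0 * (b' - b),
    by fun_prop, (h2.comp mm).add (mx.mul_const (by linarith)), by fun_prop,
    (h4.comp mm).add (mx.mul_const (by linarith)), ?_, ?_, ?_, ?_, ?_⟩
  · simp [h5]
  · simp [h6]
  · norm_num [h7]
  · norm_num [h8]
  · rintro t ⟨t0, t1⟩
    dsimp only
    rcases le_total (2 * t) 1 with h | h
    · rw [min_eq_left h, max_eq_right (by linarith)]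
      simpa using h9 (2 * t) ⟨by linarith, h⟩
    · rw [min_eq_right h, max_eq_left (by linarith), h7, h8]
      exact hs _ ⟨by linarith, by linarith⟩

lemma fp_cut {P Q : ℝ → E} {ε : ℝ} {φ ψ : ℝ → ℝ} (h1 : Continuous φ) (h2 : Monotone φ)
    (h3 : Continuous ψ) (h4 : Monotone ψ) (h5 : φ 0 = 0) (h6 : ψ 0 = 0)
    (h9 : ∀ t ∈ Set.Icc (0:ℝ) 1, dist (P (φ t)) (Q (ψ t)) ≤ ε) (T : ℝ)
    (hT : T ∈ Set.Icc (0:ℝ) 1) : fpReach P Q ε (φ T) (ψ T) := by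
  have hm : Monotone fun t : ℝ => T * t := fun x y hxy => mul_le_mul_of_nonneg_left hxy hT.1
  refine ⟨fun t => φ (T * t), fun t => ψ (T * t), by fun_prop, h2.comp hm, by fun_prop,
    h4.comp hm, by simp [h5], by simp [h6], by simp, by simp, ?_⟩
  rintro t ⟨t0, t1⟩
  exact h9 _ ⟨mul_nonneg hT.1 t0, mul_le_one₀ hT.2 t0 t1⟩

lemma fp_split {P Q : ℝ → E} {ε : ℝ} (i j : ℕ) (t : ℝ) (ht : 0 ≤ t)
    (h : fpReach P Q ε ((i + 1 : ℕ):ℝ) (j + t)) :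
    (∃ a : ℝ, (i:ℝ) ≤ a ∧ a ≤ i + 1 ∧ fpReach P Q ε a j) ∨
    (∃ y, 0 ≤ y ∧ y ≤ t ∧ fpReach P Q ε i (j + y)) := by
  obtain ⟨φ, ψ, h1, h2, h3, h4, h5, h6, h7, h8, h9⟩ := h
  push_cast at h7
  obtain ⟨T, hT, hTi⟩ := intermediate_value_Icc (zero_le_one' ℝ) h1.continuousOn
    (show (i:ℝ) ∈ Set.Icc (φ 0) (φ 1) from ⟨by rw [h5]; positivity, by rw [h7]; linarith⟩)
  rcases le_total (j:ℝ) (ψ T) with hj | hj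
  · right
    have hle := h4 hT.2
    refine ⟨ψ T - j, by linarith, by linarith, ?_⟩
    have := fp_cut h1 h2 h3 h4 h5 h6 h9 T hT
    rw [hTi] at this
    simpa using this
  · left
    obtain ⟨S, hS, hSj⟩ := intermediate_value_Icc hT.2 h3.continuousOn
      (show (j:ℝ) ∈ Set.Icc (ψ T) (ψ 1) from ⟨hj, by rw [h8]; linarith⟩)
    have := fp_cut h1 h2 h3 h4 h5 h6 h9 S ⟨hT.1.trans hS.1, hS.2⟩
    rw [hSj] at this
    have e1 := h2 hS.1
    have e2 := h2 hS.2
    exact ⟨φ S, by linarith, by linarith, this⟩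

lemma fp_cell (v w : ℕ → E) {ε : ℝ} (i j : ℕ) (a b a' b' : ℝ) (ha : (i:ℝ) ≤ a) (haa : a ≤ a')
    (ha' : a' ≤ i + 1) (hb : (j:ℝ) ≤ b) (hbb : b ≤ b') (hb' : b' ≤ j + 1)
    (h : fpReach (fpPl v) (fpPl w) ε a b) (h' : dist (fpPl v a') (fpPl w b') ≤ ε) :
    fpReach (fpPl v) (fpPl w) ε a' b' := by
  refine h.extend haa hbb ?_
  rintro s ⟨s0, s1⟩
  have hd := h.dist_le
  have e1 : fpPl v (a + s * (a' - a)) = (1 - s) • fpPl v a + s • fpPl v a' := by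
    rw [fpPl_eq v i a ha (by linarith), fpPl_eq v i a' (by linarith) ha',
      fpPl_eq v i _ (by nlinarith) (by nlinarith)]
    module
  have e2 : fpPl w (b + s * (b' - b)) = (1 - s) • fpPl w b + s • fpPl w b' := by
    rw [fpPl_eq w j b hb (by linarith), fpPl_eq w j b' (by linarith) hb',
      fpPl_eq w j _ (by nlinarith) (by nlinarith)]
    module
  rw [dist_eq_norm] at hd h' ⊢
  have e3 : fpPl v (a + s * (a' - a)) - fpPl w (b + s * (b' - b)) =
      (1 - s) • (fpPl v a - fpPl w b) + s • (fpPl v a' - fpPl w b') := by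
    rw [e1, e2]; module
  rw [e3]
  refine (norm_add_le _ _).trans ?_
  rw [norm_smul, norm_smul, Real.norm_of_nonneg (by linarith), Real.norm_of_nonneg s0]
  nlinarith

lemma fp_edge (w : ℕ → E) (j : ℕ) (b c : ℝ) (hb : (j:ℝ) ≤ b) (hb' : b ≤ j + 1)
    (hc : (j:ℝ) ≤ c) (hc' : c ≤ j + 1) :
    dist (fpPl w b) (fpPl w c) = |b - c| * ‖w (j+1) - w j‖ := by
  rw [fpPl_eq w j b hb hb', fpPl_eq w j c hc hc', dist_eq_norm, ← Real.norm_eq_abs, ← norm_smul]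
  congr 1
  module

lemma fp_move (v w : ℕ → E) {ε : ℝ} (i j : ℕ) (y z : ℝ) (hy : 0 ≤ y) (hy' : y ≤ 1)
    (hz : 0 ≤ z) (hz' : z ≤ 1) (h : fpReach (fpPl v) (fpPl w) ε i (j + z)) :
    fpReach (fpPl v) (fpPl w) (ε + |z - y| * ‖w (j+1) - w j‖) i (j + y) := by
  have hL : 0 ≤ |z - y| * ‖w (j+1) - w j‖ := by positivity
  rcases le_total z y with hzy | hzy
  · have hd := h.dist_le
    refine fp_cell v w i j i (j + z) i (j + y) le_rfl le_rfl (by linarith) (by linarith)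
      (by linarith) (by linarith) (h.mono (by linarith)) ?_
    refine (dist_triangle _ (fpPl w (j + z)) _).trans ?_
    rw [fp_edge w j (j + z) (j + y) (by linarith) (by linarith) (by linarith) (by linarith)]
    rw [show (j:ℝ) + z - (j + y) = z - y by ring]
    linarith
  · obtain ⟨φ, ψ, h1, h2, h3, h4, h5, h6, h7, h8, h9⟩ := h
    refine ⟨φ, fun t => min (ψ t) (j + y), h1, h2, by fun_prop, h4.min monotone_const, h5, ?_, h7,
      ?_, ?_⟩
    · simp only [h6]; exact min_eq_left (by positivity)
    · simp only [h8]; exact min_eq_right (by linarith)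
    · intro t ht
      have hd := h9 t ht
      have hle := h4 ht.2
      rw [h8] at hle
      dsimp only
      rcases le_total (ψ t) (j + y) with hh | hh
      · rw [min_eq_left hh]; linarith
      · rw [min_eq_right hh]
        refine (dist_triangle _ (fpPl w (ψ t)) _).trans ?_
        rw [fp_edge w j (ψ t) (j + y) (by linarith) (by linarith) (by linarith) (by linarith)]
        have : |ψ t - (j + y)| ≤ |z - y| := by
          rw [abs_of_nonneg (by linarith), abs_of_nonneg (by linarith)]; linarith
        have := mul_le_mul_of_nonneg_right this (norm_nonneg (w (j+1) - w j))
        linarith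

/-- Reachable parameter set. -/
def fpR (v w : ℕ → E) (δ : ℝ) (j k : ℕ) : Set ℝ :=
  {t | t ∈ Set.Icc (0:ℝ) 1 ∧ ∀ ε > δ, fpReach (fpPl v) (fpPl w) ε k (j + t)}

lemma fp_closed (v w : ℕ → E) (δ : ℝ) (i j : ℕ) (y : ℝ) (hy : y ∈ Set.Icc (0:ℝ) 1)
    (h : ∀ ε > δ, ∀ η > 0, ∃ z ∈ Set.Icc (0:ℝ) 1, |z - y| < η ∧
      fpReach (fpPl v) (fpPl w) ε i (j + z)) : y ∈ fpR v w δ j i := by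
  refine ⟨hy, fun ε hε => ?_⟩
  set L := ‖w (j+1) - w j‖ with hLd
  have hL : 0 ≤ L := norm_nonneg _
  obtain ⟨z, hz, hzy, hr⟩ := h ((δ + ε) / 2) (by linarith) ((ε - δ) / 2 / (L + 1))
    (div_pos (by linarith) (by linarith))
  refine (fp_move v w i j y z hy.1 hy.2 hz.1 hz.2 hr).mono ?_
  rw [lt_div_iff₀ (by linarith)] at hzy
  have := abs_nonneg (z - y)
  nlinarith

lemma fp_sInf_mem (v w : ℕ → E) (δ : ℝ) (i j : ℕ) (h : (fpR v w δ j i).Nonempty) :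
    sInf (fpR v w δ j i) ∈ fpR v w δ j i := by
  have hbd : BddBelow (fpR v w δ j i) := ⟨0, fun x hx => hx.1.1⟩
  obtain ⟨x, hx⟩ := id h
  refine fp_closed v w δ i j _ ⟨le_csInf h fun x hx => hx.1.1, (csInf_le hbd hx).trans hx.1.2⟩ ?_
  intro ε hε η hη
  obtain ⟨z, hz, hzl⟩ := Real.lt_sInf_add_pos h hη
  refine ⟨z, hz.1, ?_, hz.2 ε hε⟩
  rw [abs_of_nonneg (by linarith [csInf_le hbd hz])]
  linarith

lemma fp_left (v w : ℕ → E) (δ : ℝ) (i j : ℕ) (t : ℝ) (ht1 : t ≤ 1)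
    (h : ∀ ε > δ, ∃ y, 0 ≤ y ∧ y ≤ t ∧ fpReach (fpPl v) (fpPl w) ε i (j + y)) :
    ∃ y ∈ fpR v w δ j i, y ≤ t := by
  have h' : ∀ n : ℕ, ∃ y, y ∈ Set.Icc 0 t ∧
      fpReach (fpPl v) (fpPl w) (δ + 1 / ((n:ℝ) + 1)) i (j + y) := fun n => by
    obtain ⟨y, a, b, c⟩ := h (δ + 1 / ((n:ℝ) + 1)) (by
      have : 0 < 1 / ((n:ℝ) + 1) := by positivity
      linarith)
    exact ⟨y, ⟨a, b⟩, c⟩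
  choose Y hY hYr using h'
  obtain ⟨y, hy, f, hf, hlim⟩ := isCompact_Icc.tendsto_subseq hY
  refine ⟨y, fp_closed v w δ i j y ⟨hy.1, hy.2.trans ht1⟩ ?_, hy.2⟩
  intro ε hε η hη
  have e1 := (Metric.tendsto_nhds.1 hlim) η hη
  have e2 : ∀ᶠ n : ℕ in Filter.atTop, 1 / ((f n : ℝ) + 1) < ε - δ :=
    hf.tendsto_atTop.eventually
      ((tendsto_one_div_add_atTop_nhds_zero_nat (𝕜 := ℝ)).eventually_lt_const (by linarith))
  obtain ⟨n, a, b⟩ := (e1.and e2).exists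
  exact ⟨Y (f n), ⟨(hY _).1, (hY _).2.trans ht1⟩, a, (hYr (f n)).mono (by linarith)⟩

/-- Ball parameter set. -/
def fpB (v w : ℕ → E) (δ : ℝ) (j k : ℕ) : Set ℝ :=
  {t | t ∈ Set.Icc (0:ℝ) 1 ∧ dist (v k) ((1-t) • w j + t • w (j+1)) ≤ δ}

lemma fpPl_nat (v : ℕ → E) (k : ℕ) : fpPl v k = v k := by
  rw [fpPl_eq v k k le_rfl (by linarith)]; simp

lemma fpPl_add (w : ℕ → E) (j : ℕ) (t : ℝ) (h0 : 0 ≤ t) (h1 : t ≤ 1) :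
    fpPl w (j + t) = (1-t) • w j + t • w (j+1) := by
  rw [fpPl_eq w j _ (by linarith) (by linarith)]; simp

lemma fp_sub (v w : ℕ → E) (δ : ℝ) (j k : ℕ) : fpR v w δ j k ⊆ fpB v w δ j k := by
  rintro t ⟨ht, h⟩
  refine ⟨ht, le_of_forall_gt_imp_ge_of_dense fun ε hε => ?_⟩
  have := (h ε hε).dist_le
  rwa [fpPl_nat, fpPl_add w j t ht.1 ht.2] at this

lemma fp_up (v w : ℕ → E) (δ : ℝ) (j i : ℕ) (y s : ℝ) (hy : y ∈ fpR v w δ j i)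
    (hs : s ∈ fpB v w δ j (i+1)) (hys : y ≤ s) : s ∈ fpR v w δ j (i+1) := by
  refine ⟨hs.1, fun ε hε => ?_⟩
  have h0 := hy.1.1
  have h1 := hs.1.2
  refine fp_cell v w i j i (j + y) _ (j + s) le_rfl (by push_cast; linarith)
    (by push_cast; linarith) (by linarith) (by linarith) (by linarith) (hy.2 ε hε) ?_
  rw [fpPl_nat, fpPl_add w j s hs.1.1 hs.1.2]
  exact hs.2.trans hε.le

lemma fpB_convex (v w : ℕ → E) (δ : ℝ) (j k : ℕ) (x y z : ℝ) (hx : x ∈ fpB v w δ j k)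
    (hz : z ∈ fpB v w δ j k) (hxy : x < y) (hyz : y ≤ z) : y ∈ fpB v w δ j k := by
  refine ⟨⟨hx.1.1.trans hxy.le, hyz.trans hz.1.2⟩, ?_⟩
  have hxz : 0 < z - x := by linarith
  have h1 := hx.2
  have h2 := hz.2
  obtain ⟨s, s0, s1, rfl⟩ : ∃ s : ℝ, 0 ≤ s ∧ s ≤ 1 ∧ y = x + s * (z - x) :=
    ⟨(y - x) / (z - x), div_nonneg (by linarith) hxz.le, by rw [div_le_one hxz]; linarith,
      by field_simp; ring⟩
  rw [dist_eq_norm] at h1 h2 ⊢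
  have e3 : v k - ((1 - (x + s * (z - x))) • w j + (x + s * (z - x)) • w (j+1)) =
      (1 - s) • (v k - ((1 - x) • w j + x • w (j+1))) +
      s • (v k - ((1 - z) • w j + z • w (j+1))) := by module
  rw [e3]
  refine (norm_add_le _ _).trans ?_
  rw [norm_smul, norm_smul, Real.norm_of_nonneg (by linarith), Real.norm_of_nonneg s0]
  nlinarith

lemma fp_step (v w : ℕ → E) (δ : ℝ) (j i : ℕ) (hne : (fpR v w δ j (i+1)).Nonempty) :
    ((fpR v w δ j i).Nonempty ∧ sInf (fpR v w δ j (i+1)) = sInf (fpR v w δ j i)) ∨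
    ((fpB v w δ j (i+1)).Nonempty ∧ sInf (fpR v w δ j (i+1)) = sInf (fpB v w δ j (i+1))) := by
  have hsub := fp_sub v w δ j (i+1)
  by_cases hbot : ∀ ε > δ, ∃ a : ℝ, (i:ℝ) ≤ a ∧ a ≤ i + 1 ∧ fpReach (fpPl v) (fpPl w) ε a j
  · right
    have : fpB v w δ j (i+1) ⊆ fpR v w δ j (i+1) := by
      intro s hs
      refine ⟨hs.1, fun ε hε => ?_⟩
      obtain ⟨a, ha, ha', hr⟩ := hbot ε hε
      have h0 := hs.1.1
      have h1 := hs.1.2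
      refine fp_cell v w i j a j _ (j + s) ha (by push_cast; linarith)
        (by push_cast; linarith) (by linarith) (by linarith) (by linarith) hr ?_
      rw [fpPl_nat, fpPl_add w j s hs.1.1 hs.1.2]
      exact hs.2.trans hε.le
    exact ⟨hne.mono hsub, by rw [Set.Subset.antisymm hsub this]⟩
  · push Not at hbot
    obtain ⟨ε₀, hε₀, hno⟩ := hbot
    have hleft : ∀ t ∈ fpR v w δ j (i+1), ∃ y ∈ fpR v w δ j i, y ≤ t := by
      intro t ht
      refine fp_left v w δ i j t ht.1.2 fun ε hε => ?_
      rcases fp_split i j t ht.1.1 (ht.2 (min ε ε₀) (lt_min hε hε₀)) with ⟨a, ha, ha', hr⟩ | h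
      · exact absurd (hr.mono (min_le_right _ _)) (hno a ha ha')
      · obtain ⟨y, a, b, c⟩ := h
        exact ⟨y, a, b, c.mono (min_le_left _ _)⟩
    obtain ⟨r, hr⟩ := id hne
    obtain ⟨y, hy, hyr⟩ := hleft r hr
    have hneI : (fpR v w δ j i).Nonempty := ⟨y, hy⟩
    have hbd : BddBelow (fpR v w δ j i) := ⟨0, fun x hx => hx.1.1⟩
    have hl := fp_sInf_mem v w δ i j hneI
    have hlow : ∀ t ∈ fpR v w δ j (i+1), sInf (fpR v w δ j i) ≤ t := by
      intro t ht
      obtain ⟨y, hy, hyt⟩ := hleft t ht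
      exact (csInf_le hbd hy).trans hyt
    by_cases hb : ∀ b ∈ fpB v w δ j (i+1), sInf (fpR v w δ j i) ≤ b
    · right
      have : fpB v w δ j (i+1) ⊆ fpR v w δ j (i+1) := fun s hs =>
        fp_up v w δ j i _ s hl hs (hb s hs)
      exact ⟨hne.mono hsub, by rw [Set.Subset.antisymm hsub this]⟩
    · left
      push Not at hb
      obtain ⟨b, hbB, hbl⟩ := hb
      have hlB := fpB_convex v w δ j (i+1) b _ r hbB (hsub hr) hbl (hlow r hr)
      have hlR := fp_up v w δ j i _ _ hl hlB le_rfl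
      exact ⟨hneI, le_antisymm (csInf_le ⟨0, fun x hx => hx.1.1⟩ hlR) (le_csInf hne hlow)⟩

lemma fp_main (v w : ℕ → E) (δ : ℝ) (j i' m : ℕ) (hne : (fpR v w δ j (i'+m)).Nonempty) :
    ((fpR v w δ j i').Nonempty ∧ sInf (fpR v w δ j (i'+m)) = sInf (fpR v w δ j i')) ∨
    (∃ k, i' + 1 ≤ k ∧ k ≤ i' + m ∧ (fpB v w δ j k).Nonempty ∧
      sInf (fpR v w δ j (i'+m)) = sInf (fpB v w δ j k)) := by
  induction m with
  | zero => exact Or.inl ⟨hne, rfl⟩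
  | succ m ih =>
    rcases fp_step v w δ j (i' + m) hne with ⟨h, e⟩ | ⟨h, e⟩
    · rcases ih h with ⟨h2, e2⟩ | ⟨k, k1, k2, k3, k4⟩
      · exact Or.inl ⟨h2, e.trans e2⟩
      · exact Or.inr ⟨k, k1, by omega, k3, e.trans k4⟩
    · exact Or.inr ⟨i' + m + 1, by omega, by omega, h, e⟩

lemma fp_frechet_le_iff (n m : ℕ) (v w : ℕ → E) (δ : ℝ) (hδ : 0 ≤ δ) :
    frechetDist (polyline n v) (polyline m w) ≤ δ ↔ ∀ ε > δ, ∃ φ ψ : ℝ → ℝ,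
      IsReparam φ ∧ IsReparam ψ ∧
      ∀ t ∈ Set.Icc (0:ℝ) 1, dist (polyline n v (φ t)) (polyline m w (ψ t)) ≤ ε := by
  rw [frechetDist]
  constructor
  · intro h ε hε
    have hn : {δ : ℝ | 0 ≤ δ ∧ ∃ φ ψ : ℝ → ℝ, IsReparam φ ∧ IsReparam ψ ∧
        ∀ t ∈ Set.Icc (0:ℝ) 1, dist (polyline n v (φ t)) (polyline m w (ψ t)) ≤ δ}.Nonempty := by
      refine ⟨2 * ∑ k ∈ Finset.range (n + 2), ‖v k‖ + 2 * ∑ k ∈ Finset.range (m + 2), ‖w k‖,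
        by positivity, id, id, ⟨continuous_id, monotone_id, rfl, rfl⟩,
        ⟨continuous_id, monotone_id, rfl, rfl⟩, ?_⟩
      intro t ht
      rw [dist_eq_norm]
      exact (norm_sub_le _ _).trans (add_le_add (fp_bound n v t ht.1 ht.2)
        (fp_bound m w t ht.1 ht.2))
    obtain ⟨x, ⟨_, φ, ψ, h1, h2, h3⟩, hx⟩ := exists_lt_of_csInf_lt hn (h.trans_lt hε)
    exact ⟨φ, ψ, h1, h2, fun t ht => (h3 t ht).trans hx.le⟩
  · intro h
    refine le_of_forall_gt_imp_ge_of_dense fun ε hε => ?_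
    exact csInf_le ⟨0, fun x hx => hx.1⟩ ⟨hδ.trans (le_of_lt hε), h ε hε⟩

lemma fp_coord (k : ℕ) (φ : ℝ → ℝ) (h1 : Continuous φ) (h2 : Monotone φ) (h3 : φ 0 = 0)
    (h4 : φ 1 = k) : ∃ φ', IsReparam φ' ∧ ∀ t ∈ Set.Icc (0:ℝ) 1, φ' t * k = φ t := by
  rcases Nat.eq_zero_or_pos k with rfl | hk
  · refine ⟨id, ⟨continuous_id, monotone_id, rfl, rfl⟩, fun t ht => ?_⟩
    have a := h2 ht.1
    have b := h2 ht.2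
    simp only [Nat.cast_zero] at h4 ⊢
    linarith
  · have hk' : (0:ℝ) < k := by exact_mod_cast hk
    refine ⟨fun t => φ t / k, ⟨by fun_prop, fun x y hxy => ?_, by simp [h3], ?_⟩, fun t _ => ?_⟩
    · exact div_le_div_of_nonneg_right (h2 hxy) hk'.le
    · simp [h4, hk'.ne']
    · field_simp

lemma fp_reparam_mem {φ : ℝ → ℝ} (h : IsReparam φ) {t : ℝ} (ht : t ∈ Set.Icc (0:ℝ) 1) :
    0 ≤ φ t ∧ φ t ≤ 1 := by
  obtain ⟨_, h2, h3, h4⟩ := h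
  exact ⟨h3 ▸ h2 ht.1, h4 ▸ h2 ht.2⟩

lemma fpG_cont (j : ℕ) (t : ℝ) : Continuous (fpG j t) := by
  unfold fpG; fun_prop

lemma fpG_mono (j : ℕ) (t : ℝ) (ht : 0 ≤ t) : Monotone (fpG j t) := by
  intro x y hxy
  unfold fpG
  gcongr

lemma fp_sub_poly (w : ℕ → E) (j : ℕ) (t s : ℝ) (ht : t ∈ Set.Icc (0:ℝ) 1) (h0 : 0 ≤ s)
    (h1 : s ≤ 1) : polyline (j+1) (subVert w j ((1-t) • w j + t • w (j+1))) s =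
      fpPl w (fpG j t (s * (j + 1))) := by
  rw [fp_polyline_eq _ _ _ h0 h1]
  push_cast
  have : (0:ℝ) ≤ j := by positivity
  exact fp_subVert_eq w j t _ ht.1 ht.2 (by positivity) (by nlinarith)

/-- Second coordinate: time change `c`, reparameterization and inverse of `fpG`. -/
lemma fp_coord2 (j : ℕ) (t : ℝ) (ht : t ∈ Set.Icc (0:ℝ) 1) (ψ : ℝ → ℝ) (h1 : Continuous ψ)
    (h2 : Monotone ψ) (h3 : ψ 0 = 0) (h4 : ψ 1 = j + t) :
    ∃ c ψ' : ℝ → ℝ, Continuous c ∧ Monotone c ∧ c 0 = 0 ∧ c 1 = 1 ∧ IsReparam ψ' ∧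
      ∀ s ∈ Set.Icc (0:ℝ) 1, fpG j t (ψ' s * (j + 1)) = ψ (c s) := by
  have hj : (0:ℝ) ≤ j := by positivity
  have hj1 : (0:ℝ) < j + 1 := by positivity
  rcases ht.1.eq_or_lt with h0 | h0
  · subst h0
    have mm : Monotone fun t : ℝ => min (2 * t) 1 := fun x y hxy => by
      dsimp only; gcongr
    have mx : Monotone fun t : ℝ => max (2 * t - 1) 0 := fun x y hxy => by
      dsimp only; gcongr
    refine ⟨fun s => min (2 * s) 1,
      fun s => (ψ (min (2 * s) 1) + max (2 * s - 1) 0) * ((j:ℝ) + 1)⁻¹,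
      by fun_prop, mm, by simp, by norm_num,
      ⟨by fun_prop, ((h2.comp mm).add mx).mul_const (by positivity), by simp [h3], ?_⟩, ?_⟩
    · norm_num [h4]
      field_simp
    · intro s hs
      dsimp only
      rw [mul_assoc, inv_mul_cancel₀ hj1.ne', mul_one, fpG, zero_mul, add_zero]
      rcases le_total (2 * s) 1 with h | h
      · rw [min_eq_left h, max_eq_right (by linarith), add_zero]
        have := h2 h
        rw [h4] at this
        exact min_eq_left (by linarith)
      · rw [min_eq_right h, h4]
        have := le_max_right (2 * s - 1) 0
        rw [min_eq_right (by linarith)]; ring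
  · refine ⟨id, fun s => (min (ψ s) j + max (ψ s - j) 0 / t) * ((j:ℝ) + 1)⁻¹,
      continuous_id, monotone_id, rfl, rfl, ⟨by fun_prop, fun x y hxy => ?_, ?_, ?_⟩, ?_⟩
    · have := h2 hxy
      dsimp only
      gcongr
    · simp [h3]
    · simp only [h4]
      rw [min_eq_right (by linarith), max_eq_left (by linarith)]
      field_simp
      ring
    · intro s hs
      dsimp only [id]
      rw [mul_assoc, inv_mul_cancel₀ hj1.ne', mul_one, fpG]
      rcases le_total (ψ s) j with h | h
      · rw [min_eq_left h, max_eq_right (by linarith)]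
        simp [h]
      · rw [min_eq_right h, max_eq_left (by linarith)]
        have : 0 ≤ (ψ s - j) / t := div_nonneg (by linarith) h0.le
        rw [min_eq_right (by linarith), max_eq_left (by linarith)]
        field_simp
        ring

lemma fp_R_eq (v w : ℕ → E) (δ : ℝ) (hδ : 0 ≤ δ) (j k : ℕ) :
    {t : ℝ | t ∈ Set.Icc (0:ℝ) 1 ∧ frechetDist (polyline k v)
        (polyline (j+1) (subVert w j ((1-t) • w j + t • w (j+1)))) ≤ δ} = fpR v w δ j k := by
  ext t
  simp only [fpR, Set.mem_setOf_eq]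
  refine and_congr_right fun ht => ?_
  rw [fp_frechet_le_iff _ _ _ _ _ hδ]
  refine forall_congr' fun ε => imp_congr_right fun hε => ?_
  have hj : (0:ℝ) ≤ j := by positivity
  constructor
  · rintro ⟨φ, ψ, h1, h2, h3⟩
    refine ⟨fun s => φ s * k, fun s => fpG j t (ψ s * (j + 1)), h1.1.mul_const _,
      h1.2.1.mul_const (by positivity), (fpG_cont j t).comp (h2.1.mul_const _),
      (fpG_mono j t ht.1).comp (h2.2.1.mul_const (by positivity)), by simp [h1.2.2.1],
      by simp [h2.2.2.1, fpG], by simp [h1.2.2.2], by simp [h2.2.2.2, fpG], ?_⟩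
    intro s hs
    have a := fp_reparam_mem h1 hs
    have b := fp_reparam_mem h2 hs
    have := h3 s hs
    rwa [fp_polyline_eq _ _ _ a.1 a.2, fp_sub_poly w j t _ ht b.1 b.2] at this
  · rintro ⟨φ, ψ, h1, h2, h3, h4, h5, h6, h7, h8, h9⟩
    obtain ⟨c, ψ', c1, c2, c3, c4, c5, c6⟩ := fp_coord2 j t ht ψ h3 h4 h6 h8
    obtain ⟨φ', p1, p2⟩ := fp_coord k (φ ∘ c) (h1.comp c1) (h2.comp c2) (by simp [c3, h5])
      (by simp [c4, h7])
    refine ⟨φ', ψ', p1, c5, fun s hs => ?_⟩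
    have a := fp_reparam_mem p1 hs
    have b := fp_reparam_mem c5 hs
    rw [fp_polyline_eq _ _ _ a.1 a.2, fp_sub_poly w j t _ ht b.1 b.2, p2 s hs, c6 s hs]
    exact h9 (c s) ⟨c3 ▸ c2 hs.1, c4 ▸ c2 hs.2⟩

end fp

/-- parameterize the edge `w j w(j+1)` by `t ∈ [0,1]`. Let `R k` be the
parameter set of the reachability interval `R_k[j]` and `B k` that of the ball–edge
intersection `B_{v k} ∩ w j w(j+1)`. If `R i` is nonempty, then for every `i' < i`,
the first point `ℓ_{i,j} = sInf (R i)` equals either the first point `ℓ_{i',j}` of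
`R i'` (which is then nonempty) or the start `s_{k,j} = sInf (B k)` of some nonempty
`B k` with `i' + 1 ≤ k ≤ i`. -/
theorem first_point_membership {d : ℕ} (v w : ℕ → EuclideanSpace ℝ (Fin d))
    (i i' j : ℕ) (δ : ℝ) (hδ : 0 ≤ δ) (hi' : i' < i)
    (R B : ℕ → Set ℝ)
    (hR : ∀ k, R k = {t : ℝ | t ∈ Set.Icc (0:ℝ) 1 ∧
      frechetDist (polyline k v)
        (polyline (j+1) (subVert w j ((1-t) • w j + t • w (j+1)))) ≤ δ})
    (hB : ∀ k, B k = {t : ℝ | t ∈ Set.Icc (0:ℝ) 1 ∧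
      dist (v k) ((1-t) • w j + t • w (j+1)) ≤ δ})
    (hne : (R i).Nonempty) :
    ((R i').Nonempty ∧ sInf (R i) = sInf (R i')) ∨
    (∃ k, i' + 1 ≤ k ∧ k ≤ i ∧ (B k).Nonempty ∧ sInf (R i) = sInf (B k)) := by
  obtain ⟨m, rfl⟩ : ∃ m, i = i' + m := ⟨i - i', by omega⟩
  have hR' : ∀ k, R k = fpR v w δ j k := fun k => (hR k).trans (fp_R_eq v w δ hδ j k)
  have hB' : ∀ k, B k = fpB v w δ j k := fun k => hB k
  simp only [hR', hB'] at hne ⊢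
  exact fp_main v w δ j i' m hne
end
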